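/- Let ρ and σ be nonzero positive semidefinite operators on a finite-dimensional complex inner product space H with Tr(ρσ) ≠ 0 (i.e., σ is not singular with respect to ρ). If σ = R₁ ρ R₁ + τ₁ and σ = R₂ ρ R₂ + τ₂ where R₁, R₂, τ₁, τ₂ are positive semidefinite and Tr(ρ τ₁) = Tr(ρ τ₂) = 0, then τ₁ = τ₂ and R₁ ρ R₁ = R₂ ρ R₂. In other words, the quantum Lebesgue decomposition of σ with respect to ρ into an absolutely continuous part of the form R ρ R and a part singular with respect to ρ is unique. -/

import Mathlib

open Matrix
open scoped Matrix ComplexOrder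

open scoped MatrixOrder Matrix.Norms.L2Operator in
/-- A positive semidefinite matrix is determined by its square. -/
lemma Matrix.PosSemidef.eq_of_mul_self_eq {ι : Type*} [Fintype ι] [DecidableEq ι]
    {A B : Matrix ι ι ℂ} (hA : A.PosSemidef) (hB : B.PosSemidef) (h : A * A = B * B) :
    A = B := by
  rw [← CFC.sqrt_mul_self A hA.nonneg, h, CFC.sqrt_mul_self B hB.nonneg]

open scoped MatrixOrder Matrix.Norms.L2Operator in
lemma Matrix.PosSemidef.exists_eq_conjTranspose_mul_self {ι : Type*} [Fintype ι] [DecidableEq ι]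
    {A : Matrix ι ι ℂ} (hA : A.PosSemidef) : ∃ B : Matrix ι ι ℂ, A = Bᴴ * B :=
  CStarAlgebra.nonneg_iff_eq_star_mul_self.mp hA.nonneg

lemma Matrix.PosSemidef.mul_eq_zero_of_conjTranspose_mul_mul_eq_zero
    {ι : Type*} [Fintype ι] [DecidableEq ι] {A Y : Matrix ι ι ℂ} (hA : A.PosSemidef)
    (h : Yᴴ * A * Y = 0) : A * Y = 0 := by
  obtain ⟨C, rfl⟩ := hA.exists_eq_conjTranspose_mul_self
  have hCY : C * Y = 0 := by
    rw [← Matrix.conjTranspose_mul_self_eq_zero, conjTranspose_mul, ← h]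
    simp only [Matrix.mul_assoc]
  rw [Matrix.mul_assoc, hCY, Matrix.mul_zero]

/-- If `Bᴴ * B` and `τ` are orthogonal in the trace pairing, then `τ` kills the range of `Bᴴ`. -/
lemma Matrix.PosSemidef.mul_conjTranspose_eq_zero_of_trace_eq_zero
    {ι : Type*} [Fintype ι] [DecidableEq ι] {B τ : Matrix ι ι ℂ} (hτ : τ.PosSemidef)
    (h : (Bᴴ * B * τ).trace = 0) : τ * Bᴴ = 0 := by
  obtain ⟨C, rfl⟩ := hτ.exists_eq_conjTranspose_mul_self
  have hCB : C * Bᴴ = 0 := by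
    rw [← Matrix.trace_conjTranspose_mul_self_eq_zero_iff, conjTranspose_mul,
      conjTranspose_conjTranspose, ← h, Matrix.mul_assoc Bᴴ, Matrix.trace_mul_comm Bᴴ]
    simp only [Matrix.mul_assoc]
  rw [Matrix.mul_assoc, hCB, Matrix.mul_zero]

/-- If `R₁ ρ R₁` and `R₂ ρ R₂` agree on the range of `ρ = Bᴴ * B`, then they are equal. -/
lemma Matrix.PosSemidef.mul_mul_eq_of_mul_conjTranspose_eq
    {ι : Type*} [Fintype ι] [DecidableEq ι] {B R₁ R₂ : Matrix ι ι ℂ}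
    (hR₁ : R₁.PosSemidef) (hR₂ : R₂.PosSemidef)
    (h : R₁ * (Bᴴ * B) * R₁ * Bᴴ = R₂ * (Bᴴ * B) * R₂ * Bᴴ) :
    R₁ * (Bᴴ * B) * R₁ = R₂ * (Bᴴ * B) * R₂ := by
  have hM : B * R₁ * Bᴴ = B * R₂ * Bᴴ := by
    refine (hR₁.mul_mul_conjTranspose_same B).eq_of_mul_self_eq
      (hR₂.mul_mul_conjTranspose_same B) ?_
    simpa only [Matrix.mul_assoc] using congrArg (B * ·) h
  have h' : B * R₁ * Bᴴ * (B * R₁) = B * R₂ * Bᴴ * (B * R₂) := by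
    simpa only [conjTranspose_mul, conjTranspose_conjTranspose, hR₁.isHermitian.eq,
      hR₂.isHermitian.eq, Matrix.mul_assoc] using congrArg (fun M : Matrix ι ι ℂ => Mᴴ) h
  have hD : (R₁ - R₂)ᴴ = R₁ - R₂ := (hR₁.isHermitian.sub hR₂.isHermitian).eq
  have h1 : B * R₁ * Bᴴ * (B * (R₁ - R₂)) = 0 := by
    rw [Matrix.mul_sub, Matrix.mul_sub, h', hM, sub_self]
  have h2 : B * R₂ * Bᴴ * (B * (R₁ - R₂)) = 0 := hM ▸ h1
  have key : ∀ R : Matrix ι ι ℂ, R.PosSemidef → B * R * Bᴴ * (B * (R₁ - R₂)) = 0 →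
      R * (Bᴴ * (B * (R₁ - R₂))) = 0 := by
    intro R hR hz
    apply hR.mul_eq_zero_of_conjTranspose_mul_mul_eq_zero
    have := congrArg ((R₁ - R₂) * Bᴴ * ·) hz
    simpa only [conjTranspose_mul, conjTranspose_conjTranspose, hD, Matrix.mul_assoc,
      Matrix.mul_zero] using this
  have hz : B * (R₁ - R₂) = 0 := by
    rw [← Matrix.conjTranspose_mul_self_eq_zero, conjTranspose_mul, hD, Matrix.mul_assoc,
      Matrix.sub_mul, key R₁ hR₁ h1, key R₂ hR₂ h2, sub_self]
  have hB : B * R₁ = B * R₂ := by rwa [Matrix.mul_sub, sub_eq_zero] at hz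
  have hB' : R₁ * Bᴴ = R₂ * Bᴴ := by
    simpa only [conjTranspose_mul, hR₁.isHermitian.eq, hR₂.isHermitian.eq]
      using congrArg (fun M : Matrix ι ι ℂ => Mᴴ) hB
  rw [← Matrix.mul_assoc, ← Matrix.mul_assoc, Matrix.mul_assoc _ B, Matrix.mul_assoc _ B, hB, hB']

/-- Uniqueness of the quantum Lebesgue decomposition (Lemma 3.4): if `σ` is not
singular with respect to `ρ` and `σ = R ρ R + τ` in two ways with `τ` singular
with respect to `ρ`, then the two decompositions coincide. -/
theorem stmt_5 {ι : Type*} [Fintype ι] [DecidableEq ι]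
    (ρ σ R₁ R₂ τ₁ τ₂ : Matrix ι ι ℂ)
    (hρ : ρ.PosSemidef) (hσ : σ.PosSemidef) (hρ0 : ρ ≠ 0) (hσ0 : σ ≠ 0)
    (hns : (ρ * σ).trace ≠ 0)
    (hR₁ : R₁.PosSemidef) (hτ₁ : τ₁.PosSemidef)
    (hdec₁ : σ = R₁ * ρ * R₁ + τ₁) (hsing₁ : (ρ * τ₁).trace = 0)
    (hR₂ : R₂.PosSemidef) (hτ₂ : τ₂.PosSemidef)
    (hdec₂ : σ = R₂ * ρ * R₂ + τ₂) (hsing₂ : (ρ * τ₂).trace = 0) :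
    τ₁ = τ₂ ∧ R₁ * ρ * R₁ = R₂ * ρ * R₂ := by
  obtain ⟨B, rfl⟩ := hρ.exists_eq_conjTranspose_mul_self
  have hB₁ := hτ₁.mul_conjTranspose_eq_zero_of_trace_eq_zero hsing₁
  have hB₂ := hτ₂.mul_conjTranspose_eq_zero_of_trace_eq_zero hsing₂
  have hsum := hdec₁.symm.trans hdec₂
  have heq : R₁ * (Bᴴ * B) * R₁ = R₂ * (Bᴴ * B) * R₂ := by
    apply hR₁.mul_mul_eq_of_mul_conjTranspose_eq hR₂
    simpa only [Matrix.add_mul, hB₁, hB₂, add_zero] using congrArg (· * Bᴴ) hsum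
  exact ⟨add_left_cancel (heq ▸ hsum), heq⟩
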